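/- Let S be a topological space, let {U_i}_{i∈ι} be an open cover of S admitting a subordinate (continuous) partition of unity ρ = {ρ_i}. Suppose that for each pair i, j we are given a continuous function β_{ij} : ℝ × (U_i ∩ U_j) → ℝ (the first variable is 'time' t) such that: (a) for every t and every x ∈ U_i ∩ U_j ∩ U_k, β_{ij}(t,x) + β_{jk}(t,x) + β_{ki}(t,x) is independent of t (for each triple i,j,k and each x it equals its value at t = 0); and (b) β_{ji} = −β_{ij} and β_{ii} = 0. Then there exist continuous functions α_i : ℝ × U_i → ℝ with α_i(0,x) = 0 for all x ∈ U_i, such that the modified functions β'_{ij}(t,x) := β_{ij}(t,x) + α_i(t,x) − α_j(t,x) are independent of t; in fact β'_{ij}(t,x) = β_{ij}(0,x) for all t and all x ∈ U_i ∩ U_j. Concretely one may take α_i(t,x) = −Σ_k ρ_k(x)·(β_{ik}(t,x) − β_{ik}(0,x)), each summand extended by zero outside U_k ∩ U_i. -/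

import Mathlib

open Set

/-- A locally finite sum weighted by a partition of unity on `S` is continuous at a point of `T × S`
as soon as the finitely many summands active near that point are. -/
theorem PartitionOfUnity.continuousAt_finsum_mul_snd {ι S T : Type*} [TopologicalSpace S]
    [TopologicalSpace T] (ρ : PartitionOfUnity ι S univ) (g : ι → T × S → ℝ) (p : T × S)
    (hg : ∀ k, p.2 ∈ tsupport (ρ k) → ContinuousAt (g k) p) :
    ContinuousAt (fun q : T × S => ∑ᶠ k, ρ k q.2 * g k q) p := by
  have hsum : ContinuousAt (fun q : T × S => ∑ k ∈ ρ.fintsupport p.2, ρ k q.2 * g k q) p := by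
    refine tendsto_finsetSum _ fun k hk => ?_
    exact ((ρ k).continuous.comp continuous_snd).continuousAt.mul
      (hg k ((ρ.mem_fintsupport_iff p.2 k).1 hk))
  refine hsum.congr ?_
  filter_upwards [continuous_snd.continuousAt.eventually (ρ.eventually_finsupport_subset p.2)]
    with q hq
  refine (finsum_eq_sum_of_support_subset _ fun k hk => hq ?_).symm
  exact (ρ.mem_finsupport q.2).2 (left_ne_zero_of_mul hk)

/-- On a product spacetime `ℝ × S`, if the Čech coboundary
`β i j + β j k + β k i` of the transition functions `β i j` is independent of the time
variable, then by a change of sections `α i` (vanishing at time `0`) the transition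
functions can be made independent of time: `β i j (t, x) + α i (t, x) - α j (t, x)`
equals `β i j (0, x)`. -/
theorem transition_functions_time_independent
    {ι : Type*} {S : Type*} [TopologicalSpace S]
    (U : ι → Set S) (hUopen : ∀ i, IsOpen (U i)) (hUcover : ⋃ i, U i = univ)
    (ρ : PartitionOfUnity ι S univ) (hρ : ρ.IsSubordinate U)
    (β : ι → ι → ℝ × S → ℝ)
    (hβcont : ∀ i j, ContinuousOn (β i j) (univ ×ˢ (U i ∩ U j)))
    (hconst : ∀ i j k, ∀ t : ℝ, ∀ x ∈ U i ∩ U j ∩ U k,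
        β i j (t, x) + β j k (t, x) + β k i (t, x)
          = β i j (0, x) + β j k (0, x) + β k i (0, x))
    (hskew : ∀ i j, ∀ t : ℝ, ∀ x ∈ U i ∩ U j, β j i (t, x) = - β i j (t, x))
    (hdiag : ∀ i, ∀ t : ℝ, ∀ x ∈ U i, β i i (t, x) = 0) :
    ∃ α : ι → ℝ × S → ℝ,
      (∀ i, ContinuousOn (α i) (univ ×ˢ U i)) ∧
      (∀ i, ∀ x ∈ U i, α i (0, x) = 0) ∧
      (∀ i j, ∀ t : ℝ, ∀ x ∈ U i ∩ U j,
        β i j (t, x) + α i (t, x) - α j (t, x) = β i j (0, x)) := by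
  refine ⟨fun i p => -∑ᶠ k, ρ k p.2 * (β i k p - β i k (0, p.2)), fun i p hp => ?_,
    fun i x _ => by simp, fun i j t x hx => ?_⟩
  · refine (ρ.continuousAt_finsum_mul_snd _ p fun k hk => ?_).neg.continuousWithinAt
    have hβ : ∀ s : ℝ, ContinuousAt (β i k) (s, p.2) := fun s =>
      (hβcont i k).continuousAt
        ((isOpen_univ.prod ((hUopen i).inter (hUopen k))).mem_nhds ⟨mem_univ _, hp.2, hρ k hk⟩)
    exact (hβ p.1).sub
      ((hβ 0).comp (f := fun q : ℝ × S => ((0 : ℝ), q.2)) (by fun_prop))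
  · have hfin : ∀ f : ι → ℝ, (Function.support fun k => ρ k x * f k).Finite := fun f =>
      (ρ.finsupport x).finite_toSet.subset fun k hk =>
        (ρ.mem_finsupport x).2 (left_ne_zero_of_mul hk)
    have hterm : ∀ k, ρ k x * (β i k (t, x) - β i k (0, x))
        - ρ k x * (β j k (t, x) - β j k (0, x)) = ρ k x * (β i j (t, x) - β i j (0, x)) := by
      intro k
      by_cases hk : ρ k x = 0
      · simp [hk]
      have hxk : x ∈ U k := hρ k (subset_tsupport _ hk)
      have hcocycle := hconst i j k t x ⟨hx, hxk⟩
      rw [hskew i k t x ⟨hx.1, hxk⟩, hskew i k 0 x ⟨hx.1, hxk⟩] at hcocycle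
      linear_combination -(ρ k x) * hcocycle
    have hsub := finsum_sub_distrib (hfin fun k => β i k (t, x) - β i k (0, x))
      (hfin fun k => β j k (t, x) - β j k (0, x))
    rw [finsum_congr hterm, ← finsum_mul, ρ.sum_eq_one (mem_univ x)] at hsub
    dsimp only
    linear_combination hsub
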